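/- Let 𝕂 be a number field and r₁, r₂ the number of its real embeddings and pairs of complex embeddings. Then for every complex s with 0 < Re s < 1/2: ∫₀^∞ y^{−s−1} 𝒫_{r₁,r₂}(y) dy = 2 Γ^{r₁}(−s) Γ^{r₂}(−2s)/ζ_𝕂(2s+1). -/

import Mathlib

open Complex NumberField Filter MeasureTheory Topology

/-- `Z_{r₁,r₂}(x)`, defined as the inverse Mellin transform
`(1/(2πi)) ∫_{Re s = c} Γ^{r₁}(s/2) Γ^{r₂}(s) x^{−s} ds` on the line `Re s = -1/4`
(the value is independent of the choice of `c ∈ (-1/2, 0)`). -/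
noncomputable def Z (r₁ r₂ : ℕ) (x : ℝ) : ℂ :=
  mellinInv (-(1/4)) (fun s => (Complex.Gamma (s / 2)) ^ r₁ * (Complex.Gamma s) ^ r₂) x

/-- `𝒫_{r₁,r₂}(y) = ∑_{m ≥ 1} (b_m/m) Z_{r₁,r₂}(√y/m)`. -/
noncomputable def P (r₁ r₂ : ℕ) (b : ℕ → ℝ) (y : ℝ) : ℂ :=
  ∑' m : ℕ, ((b m : ℂ) / (m : ℂ)) * Z r₁ r₂ (Real.sqrt y / m)

/-- `f` is continuous on `(0, ∞)` and its Mellin transform converges to `F` throughout the strip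
`-1 < Re s < 0`. -/
structure HasMellinOnStrip (f : ℝ → ℂ) (F : ℂ → ℂ) : Prop where
  continuousOn : ContinuousOn f (Set.Ioi 0)
  hasMellin : ∀ s : ℂ, -1 < s.re → s.re < 0 → HasMellin f s (F s)

lemma norm_exp_neg_sub_one_le {x : ℝ} (hx : 0 ≤ x) :
    ‖Complex.exp (-(x : ℂ)) - 1‖ ≤ 1 ∧ ‖Complex.exp (-(x : ℂ)) - 1‖ ≤ x := by
  have h : Complex.exp (-(x : ℂ)) - 1 = ((Real.exp (-x) - 1 : ℝ) : ℂ) := by push_cast; rfl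
  rw [h, Complex.norm_real, Real.norm_eq_abs, abs_sub_comm]
  have h1 : Real.exp (-x) ≤ 1 := Real.exp_le_one_iff.mpr (by linarith)
  rw [abs_of_nonneg (by linarith)]
  have h2 := Real.exp_pos (-x)
  have h3 := Real.add_one_le_exp (-x)
  exact ⟨by linarith, by linarith⟩

lemma continuous_exp_neg_sub_one : Continuous fun x : ℝ => Complex.exp (-(x : ℂ)) - 1 := by
  fun_prop

lemma mellinConvergent_exp_neg_sub_one {s : ℂ} (h₁ : -1 < s.re) (h₂ : s.re < 0) :
    MellinConvergent (fun x : ℝ => Complex.exp (-(x : ℂ)) - 1) s := by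
  refine mellinConvergent_of_isBigO_rpow (a := 0) (b := -1)
    (continuous_exp_neg_sub_one.locallyIntegrable.locallyIntegrableOn _) ?_ h₂ ?_ h₁
  · refine Asymptotics.IsBigO.of_bound 1 ?_
    filter_upwards [eventually_ge_atTop 0] with x hx
    simpa using (norm_exp_neg_sub_one_le hx).1
  · refine Asymptotics.IsBigO.of_bound 1 ?_
    filter_upwards [self_mem_nhdsWithin] with x hx
    have hx' : 0 < x := hx
    simpa [abs_of_pos hx'] using (norm_exp_neg_sub_one_le hx'.le).2

lemma hasMellin_exp_neg_sub_one {s : ℂ} (h₁ : -1 < s.re) (h₂ : s.re < 0) :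
    HasMellin (fun x : ℝ => Complex.exp (-(x : ℂ)) - 1) s (Complex.Gamma s) := by
  have hconv := mellinConvergent_exp_neg_sub_one h₁ h₂
  refine ⟨hconv, ?_⟩
  have hs : s ≠ 0 := by rintro rfl; simp at h₂
  have hG := Complex.GammaIntegral_convergent (s := s + 1) (by simp; linarith)
  have hGs : Complex.GammaIntegral (s + 1) = s * Complex.Gamma s := by
    rw [← Complex.Gamma_eq_integral (by simp; linarith), Complex.Gamma_add_one s hs]
  have hnorm : ∀ x : ℝ, 0 < x → ‖(Complex.exp (-(x : ℂ)) - 1) * ((x : ℂ) ^ s / s)‖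
      = ‖Complex.exp (-(x : ℂ)) - 1‖ * x ^ s.re / ‖s‖ := fun x hx => by
    rw [norm_mul, norm_div, Complex.norm_cpow_eq_rpow_re_of_pos hx, mul_div_assoc]
  have key := integral_Ioi_mul_deriv_eq_deriv_mul (a := 0) (a' := (0 : ℂ)) (b' := (0 : ℂ))
    (u := fun x : ℝ => Complex.exp (-(x : ℂ)) - 1) (v := fun x : ℝ => (x : ℂ) ^ s / s)
    (u' := fun x : ℝ => -Complex.exp (-(x : ℂ))) (v' := fun x : ℝ => (x : ℂ) ^ (s - 1))
    (fun x _ => by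
      have h := (((Complex.ofRealCLM.hasDerivAt (x := x)).neg).cexp).sub_const 1
      simpa using h)
    (fun x hx => by
      have h := hasDerivAt_ofReal_cpow_const' (x := x) (ne_of_gt hx) (r := s - 1)
        (by intro h; apply hs; linear_combination h)
      simpa using h)
    (by
      refine hconv.congr_fun (fun x _ => ?_) measurableSet_Ioi
      simp [mul_comm])
    (by
      refine IntegrableOn.congr_fun (hG.const_mul (-s⁻¹)) (fun x _ => ?_) measurableSet_Ioi
      simp; field_simp)
    (by
      rw [tendsto_zero_iff_norm_tendsto_zero]
      refine squeeze_zero' (g := fun x : ℝ => x ^ (1 + s.re) / ‖s‖)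
        (Eventually.of_forall fun x => norm_nonneg _) ?_ ?_
      · filter_upwards [self_mem_nhdsWithin] with x hx
        have hx' : 0 < x := hx
        simp only [Pi.mul_apply]
        rw [hnorm x hx', Real.rpow_add hx', Real.rpow_one]
        gcongr
        exact (norm_exp_neg_sub_one_le hx'.le).2
      · have : Tendsto (fun x : ℝ => x ^ (1 + s.re) / ‖s‖) (𝓝 0) (𝓝 (0 ^ (1 + s.re) / ‖s‖)) :=
          ((Real.continuousAt_rpow_const 0 _ (Or.inr (by linarith))).tendsto).div_const _
        rw [Real.zero_rpow (by linarith), zero_div] at this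
        exact this.mono_left nhdsWithin_le_nhds)
    (by
      rw [tendsto_zero_iff_norm_tendsto_zero]
      refine squeeze_zero' (g := fun x : ℝ => x ^ (-(-s.re)) / ‖s‖)
        (Eventually.of_forall fun x => norm_nonneg _) ?_ ?_
      · filter_upwards [eventually_gt_atTop 0] with x hx
        simp only [Pi.mul_apply]
        rw [hnorm x hx, neg_neg]
        gcongr
        have := (norm_exp_neg_sub_one_le hx.le).1
        have h' := Real.rpow_nonneg hx.le s.re
        nlinarith
      · simpa using (tendsto_rpow_neg_atTop (y := -s.re) (by linarith)).div_const ‖s‖)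
  calc mellin (fun x : ℝ => Complex.exp (-(x : ℂ)) - 1) s
      = ∫ x in Set.Ioi (0 : ℝ), (Complex.exp (-(x : ℂ)) - 1) * (x : ℂ) ^ (s - 1) := by
        simp only [mellin, smul_eq_mul, mul_comm]
    _ = s⁻¹ * Complex.GammaIntegral (s + 1) := by
        rw [key, Complex.GammaIntegral, ← integral_const_mul, sub_self, zero_sub, ← integral_neg]
        refine setIntegral_congr_fun measurableSet_Ioi fun x _ => ?_
        simp; field_simp
    _ = Complex.Gamma s := by rw [hGs]; field_simp

lemma hasMellinOnStrip_exp_neg_sub_one :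
    HasMellinOnStrip (fun x : ℝ => Complex.exp (-(x : ℂ)) - 1) Complex.Gamma :=
  ⟨continuous_exp_neg_sub_one.continuousOn, fun _ => hasMellin_exp_neg_sub_one⟩

lemma hasMellinOnStrip_exp_neg_sq_sub_one :
    HasMellinOnStrip (fun x : ℝ => 2 * (Complex.exp (-((x ^ (2 : ℝ) : ℝ) : ℂ)) - 1))
      (fun s => Complex.Gamma (s / 2)) := by
  refine ⟨?_, fun s h₁ h₂ => ?_⟩
  · simp only [Real.rpow_two]
    fun_prop
  · have hre : (s / ((2 : ℝ) : ℂ)).re = s.re / 2 := by simp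
    have h := hasMellin_exp_neg_sub_one (s := s / ((2 : ℝ) : ℂ)) (by rw [hre]; linarith)
      (by rw [hre]; linarith)
    have hc := (MellinConvergent.comp_rpow (f := fun x : ℝ => Complex.exp (-(x : ℂ)) - 1)
      (s := s) (a := 2) two_ne_zero).mpr h.1
    have hm := hasMellin_const_smul hc (2 : ℂ)
    refine ⟨hm.1, hm.2.trans ?_⟩
    rw [mellin_comp_rpow (fun x : ℝ => Complex.exp (-(x : ℂ)) - 1), h.2]
    simp

lemma HasMellinOnStrip.congr_right {f : ℝ → ℂ} {F G : ℂ → ℂ} (h : HasMellinOnStrip f F)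
    (hFG : ∀ s, F s = G s) : HasMellinOnStrip f G := by
  rwa [← funext hFG]

lemma norm_exp_neg_sub_one_le_rpow {x a : ℝ} (hx : 0 < x) (ha₀ : 0 ≤ a) (ha₁ : a ≤ 1) :
    ‖Complex.exp (-(x : ℂ)) - 1‖ ≤ x ^ a := by
  obtain ⟨h₁, h₂⟩ := norm_exp_neg_sub_one_le hx.le
  rcases le_total x 1 with h | h
  · refine h₂.trans ?_
    simpa using Real.rpow_le_rpow_of_exponent_ge hx h ha₁
  · exact h₁.trans (Real.one_le_rpow h ha₀)

lemma ofReal_integral_norm_eq_mellin (f : ℝ → ℂ) (s : ℂ) :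
    ((∫ t in Set.Ioi (0 : ℝ), ‖(t : ℂ) ^ (s - 1) • f t‖ : ℝ) : ℂ)
      = mellin (fun t => (‖f t‖ : ℂ)) s.re := by
  rw [← integral_complex_ofReal, mellin]
  refine setIntegral_congr_fun measurableSet_Ioi fun t ht => ?_
  have ht' : (0 : ℝ) < t := ht
  rw [norm_smul, Complex.norm_cpow_eq_rpow_re_of_pos ht', smul_eq_mul, Complex.ofReal_mul,
    Complex.ofReal_cpow ht'.le]
  simp

lemma integral_norm_cpow_smul_comp_mul_left (f : ℝ → ℂ) (s : ℂ) {a : ℝ} (ha : 0 < a) :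
    ∫ t in Set.Ioi (0 : ℝ), ‖(t : ℂ) ^ (s - 1) • f (a * t)‖
      = a ^ (-s.re) * ∫ t in Set.Ioi (0 : ℝ), ‖(t : ℂ) ^ (s - 1) • f t‖ := by
  have h := ofReal_integral_norm_eq_mellin (fun t => f (a * t)) s
  rw [mellin_comp_mul_left (fun t => (‖f t‖ : ℂ)) _ ha, ← ofReal_integral_norm_eq_mellin,
    ← Complex.ofReal_neg, ← Complex.ofReal_cpow ha.le, smul_eq_mul] at h
  exact_mod_cast h

lemma mellin_comp_mul_sqrt (f : ℝ → ℂ) (s : ℂ) {a : ℝ} (ha : 0 < a) :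
    mellin (fun y => f (a * Real.sqrt y)) s = 2 * ((a : ℂ) ^ (-(2 * s)) * mellin f (2 * s)) := by
  simp only [Real.sqrt_eq_rpow]
  rw [mellin_comp_rpow (fun x => f (a * x)), mellin_comp_mul_left f _ ha]
  have : s / ((1 / 2 : ℝ) : ℂ) = 2 * s := by push_cast; ring
  rw [this, abs_of_pos (by norm_num : (0 : ℝ) < 1 / 2)]
  simp

lemma mellinConvergent_comp_mul_sqrt {f : ℝ → ℂ} {s : ℂ} {a : ℝ} (ha : 0 < a)
    (h : MellinConvergent f (2 * s)) : MellinConvergent (fun y => f (a * Real.sqrt y)) s := by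
  simp only [Real.sqrt_eq_rpow]
  rw [MellinConvergent.comp_rpow (f := fun x => f (a * x)) (by norm_num),
    MellinConvergent.comp_mul_left ha]
  convert h using 1
  push_cast; ring

lemma integral_norm_cpow_smul_comp_mul_sqrt (f : ℝ → ℂ) (s : ℂ) {a : ℝ} (ha : 0 < a) :
    ∫ t in Set.Ioi (0 : ℝ), ‖(t : ℂ) ^ (s - 1) • f (a * Real.sqrt t)‖
      = 2 * (a ^ (-(2 * s.re)) * ∫ t in Set.Ioi (0 : ℝ), ‖(t : ℂ) ^ (2 * s - 1) • f t‖) := by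
  have h := ofReal_integral_norm_eq_mellin (fun t => f (a * Real.sqrt t)) s
  have h2 := ofReal_integral_norm_eq_mellin f (2 * s)
  have hre : (((2 * s).re : ℝ) : ℂ) = 2 * (s.re : ℂ) := by simp
  rw [mellin_comp_mul_sqrt (fun t => (‖f t‖ : ℂ)) _ ha, ← hre, ← h2,
    ← Complex.ofReal_neg, ← Complex.ofReal_cpow ha.le] at h
  have hre' : (2 * s).re = 2 * s.re := by simp
  rw [hre'] at h
  exact_mod_cast h

/-- The multiplicative convolution `x ↦ ∫₀^∞ f(t) g(x/t) dt/t`. -/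
noncomputable def mulConv (f g : ℝ → ℂ) (x : ℝ) : ℂ :=
  ∫ t in Set.Ioi (0 : ℝ), (t : ℂ)⁻¹ * f t * g (t⁻¹ * x)

lemma continuousOn_mulConv_kernel {f g : ℝ → ℂ} (hf : ContinuousOn f (Set.Ioi 0))
    (hg : ContinuousOn g (Set.Ioi 0)) :
    ContinuousOn (fun p : ℝ × ℝ => (p.2 : ℂ)⁻¹ * f p.2 * g (p.2⁻¹ * p.1))
      (Set.Ioi 0 ×ˢ Set.Ioi 0) := by
  refine (ContinuousOn.mul ?_ ?_).mul ?_
  · refine ContinuousOn.inv₀ (by fun_prop) fun p hp => ?_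
    exact Complex.ofReal_ne_zero.mpr (ne_of_gt hp.2)
  · exact hf.comp continuousOn_snd fun p hp => hp.2
  · refine hg.comp ((continuousOn_snd.inv₀ fun p hp => ne_of_gt hp.2).mul continuousOn_fst)
      fun p hp => ?_
    exact Set.mem_Ioi.mpr (mul_pos (inv_pos.mpr (Set.mem_Ioi.mp hp.2)) (Set.mem_Ioi.mp hp.1))

lemma continuousOn_mulConv {f g : ℝ → ℂ} {C a : ℝ} (hf : ContinuousOn f (Set.Ioi 0))
    (hf' : MellinConvergent f (-(a : ℂ))) (hg : ContinuousOn g (Set.Ioi 0)) (ha : 0 ≤ a)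
    (hbound : ∀ x, 0 < x → ‖g x‖ ≤ C * x ^ a) : ContinuousOn (mulConv f g) (Set.Ioi 0) := by
  have hC : 0 ≤ C := by simpa using (norm_nonneg _).trans (hbound 1 one_pos)
  have hK := continuousOn_mulConv_kernel hf hg
  intro x hx
  have hx' : 0 < x := hx
  have hsub : Set.Ioo 0 (x + 1) ⊆ Set.Ioi 0 := Set.Ioo_subset_Ioi_self
  suffices h : ContinuousOn (mulConv f g) (Set.Ioo 0 (x + 1)) from
    (h.continuousAt (Ioo_mem_nhds hx' (lt_add_one x))).continuousWithinAt
  refine continuousOn_of_dominated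
    (bound := fun t : ℝ => C * (x + 1) ^ a * ‖(t : ℂ) ^ (-(a : ℂ) - 1) • f t‖)
    (fun y hy => ?_) (fun y hy => ?_) (hf'.norm.const_mul _) ?_
  · exact (hK.comp (f := fun t : ℝ => (y, t)) (by fun_prop)
      fun t ht => ⟨hsub hy, ht⟩).aestronglyMeasurable measurableSet_Ioi
  · refine (ae_restrict_iff' measurableSet_Ioi).mpr (Eventually.of_forall fun t ht => ?_)
    have ht' : (0 : ℝ) < t := ht
    have hy' : 0 < y := hy.1
    rw [norm_mul, norm_mul, norm_smul, Complex.norm_cpow_eq_rpow_re_of_pos ht', norm_inv,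
      Complex.norm_real, Real.norm_of_nonneg ht'.le]
    have h1 : ‖g (t⁻¹ * y)‖ ≤ C * ((t⁻¹) ^ a * (x + 1) ^ a) := by
      refine (hbound _ (by positivity)).trans ?_
      rw [← Real.mul_rpow (by positivity) (by positivity)]
      gcongr
      exact hy.2.le
    have h2 : t ^ (-(a : ℂ) - 1).re = t⁻¹ * (t⁻¹) ^ a := by
      simp only [sub_re, neg_re, ofReal_re, one_re]
      rw [Real.rpow_sub ht', Real.rpow_neg ht'.le, Real.inv_rpow ht'.le, Real.rpow_one]
      ring
    rw [h2]
    calc t⁻¹ * ‖f t‖ * ‖g (t⁻¹ * y)‖ ≤ t⁻¹ * ‖f t‖ * (C * ((t⁻¹) ^ a * (x + 1) ^ a)) := by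
          gcongr
      _ = _ := by ring
  · refine (ae_restrict_iff' measurableSet_Ioi).mpr (Eventually.of_forall fun t ht => ?_)
    exact hK.comp (f := fun y : ℝ => (y, t)) (by fun_prop) fun y hy => ⟨hsub hy, ht⟩

lemma hasMellin_mulConv {f g : ℝ → ℂ} {s : ℂ} (hf : ContinuousOn f (Set.Ioi 0))
    (hg : ContinuousOn g (Set.Ioi 0)) (hfs : MellinConvergent f s) (hgs : MellinConvergent g s) :
    HasMellin (mulConv f g) s (mellin f s * mellin g s) := by
  have hint : Integrable (Function.uncurry fun x t : ℝ =>
      (x : ℂ) ^ (s - 1) * ((t : ℂ)⁻¹ * f t * g (t⁻¹ * x)))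
      ((volume.restrict (Set.Ioi 0)).prod (volume.restrict (Set.Ioi 0))) := by
    rw [integrable_prod_iff']
    · constructor
      · refine (ae_restrict_iff' measurableSet_Ioi).mpr (Eventually.of_forall fun t ht => ?_)
        have ht' : (0 : ℝ) < t := ht
        have := ((MellinConvergent.comp_mul_left (f := g) (s := s) (inv_pos.mpr ht')).mpr hgs)
        refine (this.const_mul ((t : ℂ)⁻¹ * f t)).congr (Eventually.of_forall fun x => ?_)
        simp only [Function.uncurry, smul_eq_mul]
        ring
      · have := (Integrable.norm hfs).mul_const
          (∫ x in Set.Ioi (0 : ℝ), ‖(x : ℂ) ^ (s - 1) • g x‖)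
        refine IntegrableOn.congr_fun this (fun t ht => ?_) measurableSet_Ioi
        have ht' : (0 : ℝ) < t := ht
        have heq : ∀ x : ℝ, ‖Function.uncurry (fun x t : ℝ =>
            (x : ℂ) ^ (s - 1) * ((t : ℂ)⁻¹ * f t * g (t⁻¹ * x))) (x, t)‖
            = t⁻¹ * ‖f t‖ * ‖(x : ℂ) ^ (s - 1) • g (t⁻¹ * x)‖ := fun x => by
          simp only [Function.uncurry, norm_mul, smul_eq_mul, norm_inv, Complex.norm_real,
            Real.norm_of_nonneg ht'.le]
          ring
        simp only [heq]
        rw [integral_const_mul, integral_norm_cpow_smul_comp_mul_left g s (inv_pos.mpr ht'),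
          norm_smul, Complex.norm_cpow_eq_rpow_re_of_pos ht', Real.inv_rpow ht'.le,
          Real.rpow_neg ht'.le, sub_re, one_re, Real.rpow_sub ht', Real.rpow_one]
        field_simp
    · rw [Measure.prod_restrict]
      refine ContinuousOn.aestronglyMeasurable (ContinuousOn.mul ?_
        (continuousOn_mulConv_kernel hf hg)) (measurableSet_Ioi.prod measurableSet_Ioi)
      intro p hp
      have : ContinuousAt (fun x : ℝ => (x : ℂ) ^ (s - 1)) p.1 :=
        continuousAt_ofReal_cpow_const _ _ (Or.inr (ne_of_gt hp.1))
      exact (this.comp continuousAt_fst).continuousWithinAt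
  constructor
  · refine (hint.integral_prod_left).congr (Eventually.of_forall fun x => ?_)
    simp only [Function.uncurry, smul_eq_mul, mulConv, integral_const_mul]
  · have : mellin (mulConv f g) s = ∫ x in Set.Ioi (0 : ℝ), ∫ t in Set.Ioi (0 : ℝ),
        (x : ℂ) ^ (s - 1) * ((t : ℂ)⁻¹ * f t * g (t⁻¹ * x)) := by
      simp only [mellin, smul_eq_mul, mulConv, integral_const_mul]
    rw [this, integral_integral_swap hint, mellin.eq_1 f, ← integral_mul_const]
    refine setIntegral_congr_fun measurableSet_Ioi fun t ht => ?_
    have ht' : (0 : ℝ) < t := ht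
    have htc : (t : ℂ) ≠ 0 := Complex.ofReal_ne_zero.mpr ht'.ne'
    have h := mellin_comp_mul_left g s (inv_pos.mpr ht')
    calc ∫ x in Set.Ioi (0 : ℝ), (x : ℂ) ^ (s - 1) * ((t : ℂ)⁻¹ * f t * g (t⁻¹ * x))
        = ((t : ℂ)⁻¹ * f t) * mellin (fun x => g (t⁻¹ * x)) s := by
          rw [mellin, ← integral_const_mul]
          refine integral_congr_ae (Eventually.of_forall fun x => ?_)
          simp only [smul_eq_mul]
          ring
      _ = (t : ℂ) ^ (s - 1) • f t * mellin g s := by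
          rw [h, Complex.ofReal_inv, Complex.inv_cpow _ _ (by
            rw [Complex.arg_ofReal_of_nonneg ht'.le]; exact Real.pi_pos.ne),
            Complex.cpow_neg, inv_inv, Complex.cpow_sub _ _ htc, Complex.cpow_one, smul_eq_mul,
            smul_eq_mul]
          ring

lemma HasMellinOnStrip.mulConv {f g : ℝ → ℂ} {F G : ℂ → ℂ} (hf : HasMellinOnStrip f F)
    (hg : HasMellinOnStrip g G) {C : ℝ} (hbound : ∀ x, 0 < x → ‖g x‖ ≤ C * x ^ (1 / 2 : ℝ)) :
    HasMellinOnStrip (mulConv f g) (fun s => F s * G s) := by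
  refine ⟨continuousOn_mulConv hf.continuousOn (hf.hasMellin _ ?_ ?_).1 hg.continuousOn
    (by norm_num) hbound, fun s h₁ h₂ => ?_⟩
  · simp; norm_num
  · simp
  · obtain ⟨hf₁, hf₂⟩ := hf.hasMellin s h₁ h₂
    obtain ⟨hg₁, hg₂⟩ := hg.hasMellin s h₁ h₂
    rw [← hf₂, ← hg₂]
    exact hasMellin_mulConv hf.continuousOn hg.continuousOn hf₁ hg₁

lemma HasMellinOnStrip.exists_mul_Gamma {f : ℝ → ℂ} {F : ℂ → ℂ} (hf : HasMellinOnStrip f F) :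
    ∃ g, HasMellinOnStrip g (fun s => F s * Complex.Gamma s) :=
  ⟨_, hf.mulConv hasMellinOnStrip_exp_neg_sub_one (C := 1) fun x hx => by
    rw [one_mul]
    exact norm_exp_neg_sub_one_le_rpow hx (by norm_num) (by norm_num)⟩

lemma HasMellinOnStrip.exists_mul_Gamma_half {f : ℝ → ℂ} {F : ℂ → ℂ}
    (hf : HasMellinOnStrip f F) :
    ∃ g, HasMellinOnStrip g (fun s => F s * Complex.Gamma (s / 2)) :=
  ⟨_, hf.mulConv hasMellinOnStrip_exp_neg_sq_sub_one (C := 2) fun x hx => by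
    have h := norm_exp_neg_sub_one_le_rpow (x := x ^ (2 : ℝ)) (a := 1 / 4) (by positivity)
      (by norm_num) (by norm_num)
    rw [← Real.rpow_mul hx.le] at h
    norm_num at h ⊢
    exact h⟩

lemma exists_hasMellinOnStrip_Gamma_pow (m n : ℕ) (h : 0 < m + n) :
    ∃ f, HasMellinOnStrip f (fun s => Complex.Gamma (s / 2) ^ m * Complex.Gamma s ^ n) := by
  induction m with
  | zero =>
    induction n with
    | zero => simp at h
    | succ n ih =>
      rcases Nat.eq_zero_or_pos n with rfl | hn
      · exact ⟨_, hasMellinOnStrip_exp_neg_sub_one.congr_right fun s => by simp⟩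
      · obtain ⟨f, hf⟩ := ih (by omega)
        obtain ⟨g, hg⟩ := hf.exists_mul_Gamma
        exact ⟨g, hg.congr_right fun s => by ring⟩
  | succ m ih =>
    rcases Nat.eq_zero_or_pos (m + n) with h0 | hmn
    · obtain ⟨rfl, rfl⟩ := Nat.add_eq_zero_iff.mp h0
      exact ⟨_, hasMellinOnStrip_exp_neg_sq_sub_one.congr_right fun s => by simp⟩
    · obtain ⟨f, hf⟩ := ih hmn
      obtain ⟨g, hg⟩ := hf.exists_mul_Gamma_half
      exact ⟨g, hg.congr_right fun s => by ring⟩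

lemma norm_Gamma_le_Gamma_re {s : ℂ} (hs : 0 < s.re) : ‖Complex.Gamma s‖ ≤ Real.Gamma s.re := by
  rw [Complex.Gamma_eq_integral hs, Real.Gamma_eq_integral hs, Complex.GammaIntegral]
  refine (norm_integral_le_integral_norm _).trans (le_of_eq ?_)
  refine setIntegral_congr_fun measurableSet_Ioi fun x hx => ?_
  have hx' : (0 : ℝ) < x := hx
  rw [norm_mul, Complex.norm_cpow_eq_rpow_re_of_pos hx', Complex.norm_real,
    Real.norm_of_nonneg (Real.exp_pos _).le]
  simp

lemma abs_mul_sqrt_one_add_sq_le_norm {a y : ℝ} (ha : |a| ≤ 1) :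
    |a| * Real.sqrt (1 + y ^ 2) ≤ ‖(a : ℂ) + y * I‖ := by
  rw [Complex.norm_add_mul_I, ← Real.sqrt_sq (abs_nonneg a), ← Real.sqrt_mul (by positivity)]
  apply Real.sqrt_le_sqrt
  have h : |a| ^ 2 ≤ 1 := pow_le_one₀ (abs_nonneg a) ha
  rw [sq_abs] at h ⊢
  nlinarith [sq_nonneg y]

lemma norm_Gamma_vertical_le {a : ℝ} (h₁ : -1 < a) (h₂ : a < 0) (y : ℝ) :
    ‖Complex.Gamma (a + y * I)‖ ≤ Real.Gamma (a + 2) / (|a| * |a + 1|) * (1 + y ^ 2)⁻¹ := by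
  set s : ℂ := a + y * I with hs
  have hre : s.re = a := by simp [hs]
  have hs0 : s ≠ 0 := fun h => by rw [h] at hre; simp at hre; linarith
  have hs1 : s + 1 ≠ 0 := fun h => by
    have := congrArg Complex.re h
    simp [hre] at this; linarith
  have hG : Complex.Gamma (s + 2) = (s + 1) * s * Complex.Gamma s := by
    rw [show s + 2 = s + 1 + 1 by ring, Complex.Gamma_add_one _ hs1, Complex.Gamma_add_one _ hs0]
    ring
  have hb := norm_Gamma_le_Gamma_re (s := s + 2) (by simp [hre]; linarith)
  rw [hG, norm_mul, norm_mul] at hb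
  simp only [add_re, hre, re_ofNat] at hb
  have e1 : |a| * Real.sqrt (1 + y ^ 2) ≤ ‖s‖ :=
    abs_mul_sqrt_one_add_sq_le_norm (abs_le.mpr ⟨by linarith, by linarith⟩)
  have e2 : |a + 1| * Real.sqrt (1 + y ^ 2) ≤ ‖s + 1‖ := by
    have := abs_mul_sqrt_one_add_sq_le_norm (a := a + 1) (y := y)
      (abs_le.mpr ⟨by linarith, by linarith⟩)
    rwa [show ((a + 1 : ℝ) : ℂ) + y * I = s + 1 by rw [hs]; push_cast; ring] at this
  have ha : 0 < |a| := abs_pos.mpr h₂.ne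
  have ha1 : 0 < |a + 1| := abs_pos.mpr (by linarith)
  have hsq : Real.sqrt (1 + y ^ 2) * Real.sqrt (1 + y ^ 2) = 1 + y ^ 2 :=
    Real.mul_self_sqrt (by positivity)
  have hprod : |a| * |a + 1| * (1 + y ^ 2) ≤ ‖s + 1‖ * ‖s‖ := by
    calc |a| * |a + 1| * (1 + y ^ 2)
        = (|a + 1| * Real.sqrt (1 + y ^ 2)) * (|a| * Real.sqrt (1 + y ^ 2)) := by
          linear_combination (-(|a| * |a + 1|)) * hsq
      _ ≤ ‖s + 1‖ * ‖s‖ := by gcongr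
  rw [← div_eq_mul_inv, div_div, le_div_iff₀ (by positivity), mul_comm]
  exact (mul_le_mul_of_nonneg_right hprod (norm_nonneg _)).trans hb

lemma continuous_Gamma_vertical {a : ℝ} (h₁ : -1 < a) (h₂ : a < 0) :
    Continuous fun y : ℝ => Complex.Gamma (a + y * I) := by
  refine continuous_iff_continuousAt.mpr fun y => ?_
  have h : ContinuousAt Complex.Gamma (a + y * I) := by
    refine (Complex.differentiableAt_Gamma _ fun m hm => ?_).continuousAt
    have := congrArg Complex.re hm
    simp at this
    rcases Nat.eq_zero_or_pos m with rfl | hm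
    · simp at this; linarith
    · have : (1 : ℝ) ≤ m := by exact_mod_cast hm
      linarith
  exact h.comp (f := fun y : ℝ => (a : ℂ) + y * I) (by fun_prop)

lemma integrable_pow_mul_pow_of_le_inv_one_add_sq {f g : ℝ → ℂ} {A B : ℝ} (hf : Continuous f)
    (hg : Continuous g) (hfA : ∀ y, ‖f y‖ ≤ A * (1 + y ^ 2)⁻¹)
    (hgB : ∀ y, ‖g y‖ ≤ B * (1 + y ^ 2)⁻¹) {m n : ℕ} (h : 0 < m + n) :
    Integrable fun y => f y ^ m * g y ^ n := by
  have hA : 0 ≤ A := by simpa using (norm_nonneg _).trans (hfA 0)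
  have hB : 0 ≤ B := by simpa using (norm_nonneg _).trans (hgB 0)
  refine (integrable_inv_one_add_sq.const_mul (A ^ m * B ^ n)).mono'
    (by fun_prop) (Eventually.of_forall fun y => ?_)
  have hle : (1 + y ^ 2)⁻¹ ≤ 1 := inv_le_one_of_one_le₀ (by nlinarith [sq_nonneg y])
  rw [norm_mul, norm_pow, norm_pow]
  calc ‖f y‖ ^ m * ‖g y‖ ^ n ≤ (A * (1 + y ^ 2)⁻¹) ^ m * (B * (1 + y ^ 2)⁻¹) ^ n := by
        gcongr
        · exact hfA y
        · exact hgB y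
    _ = A ^ m * B ^ n * ((1 + y ^ 2)⁻¹) ^ (m + n) := by ring
    _ ≤ A ^ m * B ^ n * (1 + y ^ 2)⁻¹ := by
        gcongr
        exact pow_le_of_le_one (by positivity) hle h.ne'

lemma verticalIntegrable_Gamma_pow {m n : ℕ} (h : 0 < m + n) {a : ℝ} (h₁ : -1 < a) (h₂ : a < 0) :
    Complex.VerticalIntegrable
      (fun s => Complex.Gamma (s / 2) ^ m * Complex.Gamma s ^ n) a := by
  have hhalf : ∀ y : ℝ, ((a : ℂ) + y * I) / 2 = ((a / 2 : ℝ) : ℂ) + ((y / 2 : ℝ) : ℂ) * I :=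
    fun y => by push_cast; ring
  have ha₁ : -1 < a / 2 := by linarith
  have ha₂ : a / 2 < 0 := by linarith
  refine integrable_pow_mul_pow_of_le_inv_one_add_sq
    (f := fun y : ℝ => Complex.Gamma ((a + y * I) / 2))
    (A := Real.Gamma (a / 2 + 2) / (|a / 2| * |a / 2 + 1|) * 4) ?_
    (continuous_Gamma_vertical h₁ h₂) (fun y => ?_) (norm_Gamma_vertical_le h₁ h₂) h
  · simp only [hhalf]
    exact (continuous_Gamma_vertical ha₁ ha₂).comp (f := fun y : ℝ => y / 2) (by fun_prop)
  · simp only [hhalf]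
    refine (norm_Gamma_vertical_le ha₁ ha₂ _).trans ?_
    rw [mul_assoc]
    have hG : 0 < Real.Gamma (a / 2 + 2) := Real.Gamma_pos_of_pos (by linarith)
    gcongr
    rw [inv_le_iff_one_le_mul₀ (by positivity)]
    field_simp
    nlinarith [sq_nonneg y]

lemma HasMellinOnStrip.mellinInv_eq {f : ℝ → ℂ} {F : ℂ → ℂ} (hf : HasMellinOnStrip f F) {a : ℝ}
    (h₁ : -1 < a) (h₂ : a < 0) (hF : Complex.VerticalIntegrable F a) {x : ℝ} (hx : 0 < x) :
    mellinInv a F x = f x := by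
  have hline : ∀ y : ℝ, mellin f (a + y * I) = F (a + y * I) := fun y =>
    (hf.hasMellin _ (by simpa using h₁) (by simpa using h₂)).2
  have hv : Complex.VerticalIntegrable (mellin f) a := by
    simpa only [Complex.VerticalIntegrable, hline] using hF
  rw [← mellinInv_mellin_eq a f hx (hf.hasMellin _ (by simpa using h₁) (by simpa using h₂)).1 hv
    (hf.continuousOn.continuousAt (Ioi_mem_nhds hx))]
  simp only [mellinInv, hline]

/-- The Mellin transform of a Dirichlet-type series `∑ (b m / m) f(√y / m)`. -/
lemma integral_tsum_div_mul_comp_sqrt {f : ℝ → ℂ} {b : ℕ → ℝ} {s w : ℂ}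
    (hf : MellinConvergent f (-2 * s)) (hs : 0 < s.re)
    (hb : HasSum (fun m : ℕ => (b m : ℂ) * (m : ℂ) ^ (-(2 * s + 1))) w) :
    ∫ y in Set.Ioi (0 : ℝ), (y : ℂ) ^ (-s - 1) *
        ∑' m : ℕ, ((b m : ℂ) / (m : ℂ)) * f (Real.sqrt y / m)
      = 2 * mellin f (-2 * s) * w := by
  have h2 : 2 * -s = -2 * s := by ring
  set J : ℝ := ∫ t in Set.Ioi (0 : ℝ), ‖(t : ℂ) ^ (2 * -s - 1) • f t‖
  set T : ℕ → ℝ → ℂ := fun m y =>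
    (y : ℂ) ^ (-s - 1) * (((b m : ℂ) / (m : ℂ)) * f (Real.sqrt y / m)) with hT
  have hTm : ∀ m : ℕ, T m = fun y : ℝ =>
      ((b m : ℂ) / (m : ℂ)) * ((y : ℂ) ^ (-s - 1) • f ((m : ℝ)⁻¹ * Real.sqrt y)) := fun m => by
    funext y
    simp only [hT, smul_eq_mul, div_eq_inv_mul (Real.sqrt y)]
    ring
  have hexp : (-(2 * s + 1)) ≠ 0 := fun h => by
    have := congrArg Complex.re h
    simp at this; linarith
  have hpow : ∀ m : ℕ, 0 < m → (m : ℂ) ^ (-(2 * s + 1))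
      = (m : ℂ)⁻¹ * (((m : ℝ)⁻¹ : ℝ) : ℂ) ^ (-(2 * -s)) := fun m hm => by
    have hm' : (m : ℂ) ≠ 0 := Nat.cast_ne_zero.mpr hm.ne'
    rw [Complex.ofReal_inv, Complex.ofReal_natCast, Complex.inv_cpow _ _ (by
      rw [Complex.natCast_arg]; exact Real.pi_pos.ne), Complex.cpow_neg _ (2 * -s), inv_inv,
      show -(2 * s + 1) = 2 * -s - 1 by ring, Complex.cpow_sub _ _ hm', Complex.cpow_one]
    ring
  have hint : ∀ m, Integrable (T m) (volume.restrict (Set.Ioi 0)) := fun m => by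
    rw [hTm]
    rcases Nat.eq_zero_or_pos m with rfl | hm
    · simp
    · have hm' : (0 : ℝ) < (m : ℝ)⁻¹ := by positivity
      exact Integrable.const_mul (mellinConvergent_comp_mul_sqrt hm' (by rwa [h2])) _
  have hnorm : ∀ m, ∫ y in Set.Ioi (0 : ℝ), ‖T m y‖
      = ‖(b m : ℂ) * (m : ℂ) ^ (-(2 * s + 1))‖ * (2 * J) := fun m => by
    rw [hTm]
    rcases Nat.eq_zero_or_pos m with rfl | hm
    · rw [Nat.cast_zero, Complex.zero_cpow hexp]
      simp
    · have hm' : (0 : ℝ) < (m : ℝ)⁻¹ := by positivity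
      simp only [norm_mul (_ / _ : ℂ)]
      rw [integral_const_mul, integral_norm_cpow_smul_comp_mul_sqrt f (-s) hm', hpow m hm,
        norm_mul, norm_mul, Complex.norm_cpow_eq_rpow_re_of_pos hm', norm_div, norm_inv,
        show (-(2 * -s)).re = -(2 * (-s).re) by simp]
      ring
  have hval : ∀ m, ∫ y in Set.Ioi (0 : ℝ), T m y
      = (2 * mellin f (-2 * s)) * ((b m : ℂ) * (m : ℂ) ^ (-(2 * s + 1))) := fun m => by
    rw [hTm]
    rcases Nat.eq_zero_or_pos m with rfl | hm
    · rw [Nat.cast_zero, Complex.zero_cpow hexp]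
      simp
    · have hm' : (0 : ℝ) < (m : ℝ)⁻¹ := by positivity
      have := mellin_comp_mul_sqrt f (-s) hm'
      rw [mellin] at this
      rw [integral_const_mul, this, hpow m hm, h2]
      ring
  have hsum : Summable fun m => ∫ y in Set.Ioi (0 : ℝ), ‖T m y‖ := by
    simp only [hnorm]
    exact hb.summable.norm.mul_right _
  have key := hasSum_integral_of_summable_integral_norm hint hsum
  simp only [hval] at key
  rw [← key.unique (hb.mul_left _)]
  simp only [hT, tsum_mul_left]

/-- Lemma 4.2 of Dixit–Gupta–Vatwani: for `0 < Re s < 1/2`,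
`∫₀^∞ y^{-s-1} 𝒫_{r₁,r₂}(y) dy = 2 Γ^{r₁}(-s) Γ^{r₂}(-2s)/ζ_K(2s+1)`. -/
theorem mellin_of_P
    (K : Type*) [Field K] [NumberField K] (ζK : ℂ → ℂ)
    (hζ_an : ∀ s : ℂ, s ≠ 1 → DifferentiableAt ℂ ζK s)
    (hζ_ser : ∀ s : ℂ, 1 < s.re →
      HasSum (fun I : {I : Ideal (𝓞 K) // I ≠ ⊥} =>
        ((Ideal.absNorm I.1 : ℕ) : ℂ) ^ (-s)) (ζK s))
    (hζ_pole : ∃ A : ℂ, A ≠ 0 ∧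
      Tendsto (fun s : ℂ => (s - 1) * ζK s) (𝓝[≠] (1 : ℂ)) (𝓝 A))
    (b : ℕ → ℝ)
    (hb : ∀ s : ℂ, 1 < s.re →
      HasSum (fun m : ℕ => (b m : ℂ) * (m : ℂ) ^ (-s)) (ζK s)⁻¹)
    (r₁ r₂ : ℕ)
    (hr₁ : r₁ = InfinitePlace.nrRealPlaces K)
    (hr₂ : r₂ = InfinitePlace.nrComplexPlaces K)
    (s : ℂ) (hs₁ : 0 < s.re) (hs₂ : s.re < 1/2) :
    ∫ y in Set.Ioi (0 : ℝ), (y : ℂ) ^ (-s - 1) * P r₁ r₂ b y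
      = 2 * (Complex.Gamma (-s)) ^ r₁ * (Complex.Gamma (-2 * s)) ^ r₂ /
          ζK (2 * s + 1) := by
  have hr : 0 < r₁ + r₂ := by
    rw [hr₁, hr₂, ← InfinitePlace.card_eq_nrRealPlaces_add_nrComplexPlaces]
    exact Fintype.card_pos
  obtain ⟨f, hf⟩ := exists_hasMellinOnStrip_Gamma_pow r₁ r₂ hr
  have hZ : ∀ x : ℝ, 0 < x → Z r₁ r₂ x = f x := fun x hx =>
    hf.mellinInv_eq (by norm_num) (by norm_num)
      (verticalIntegrable_Gamma_pow hr (by norm_num) (by norm_num)) hx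
  obtain ⟨hconv, hval⟩ := hf.hasMellin (-2 * s) (by simp; linarith) (by simpa using hs₁)
  have hP : ∀ y : ℝ, 0 < y →
      P r₁ r₂ b y = ∑' m : ℕ, ((b m : ℂ) / (m : ℂ)) * f (Real.sqrt y / m) := fun y hy => by
    refine tsum_congr fun m => ?_
    rcases Nat.eq_zero_or_pos m with rfl | hm
    · simp
    · rw [hZ _ (by positivity)]
  have hmain := integral_tsum_div_mul_comp_sqrt hconv hs₁
    (hb (2 * s + 1) (by simpa using hs₁))
  rw [hval, show -2 * s / 2 = -s by ring] at hmain
  calc ∫ y in Set.Ioi (0 : ℝ), (y : ℂ) ^ (-s - 1) * P r₁ r₂ b y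
      = ∫ y in Set.Ioi (0 : ℝ), (y : ℂ) ^ (-s - 1) *
          ∑' m : ℕ, ((b m : ℂ) / (m : ℂ)) * f (Real.sqrt y / m) :=
        setIntegral_congr_fun measurableSet_Ioi fun y hy => by simp only [hP y hy]
    _ = _ := by
        rw [hmain]
        ring
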